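/- Suppose c > 0, σ ≠ 0 and β ≠ 0, and set η = √(β² + 2cσ²) and A(τ) := 2c(e^{2ητ} − 1)/(β − η − (β + η)e^{2ητ}) for τ ≥ 0. Define B(τ) := { [αβ + (bσ² − αβ²)β/η²]·[−(β + η)(e^{2ητ} − 1) − 2η] + ((bσ² − αβ²)(β² − η²)/η²)·(e^{2ητ} − 1) + 2ηe^{ητ}·(bσ²η² − 2cσ²(bσ² − αβ²))/(βη²) } / { σ²[(β + η)(e^{2ητ} − 1) + 2η] } for τ ≥ 0. Then the denominator σ²[(β + η)(e^{2ητ} − 1) + 2η] is nonzero for all τ ≥ 0, B(0) = 0, and B is differentiable on [0,∞) with B'(τ) = αβA(τ) − βB(τ) + σ²A(τ)B(τ) − b for all τ ≥ 0. -/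

import Mathlib

open Set

/-- For `c > 0`, `σ ≠ 0`, `β ≠ 0`, the explicit function `B(τ)` has nonzero
denominator on `[0,∞)`, satisfies `B(0) = 0`, and solves `B' = αβA - βB + σ²AB - b`. -/
theorem statement17 (α β σ b c : ℝ) (hc : 0 < c) (hσ : σ ≠ 0) (hβ : β ≠ 0)
    (η : ℝ) (hη : η = Real.sqrt (β ^ 2 + 2 * c * σ ^ 2))
    (A : ℝ → ℝ)
    (hA : ∀ τ, A τ = 2 * c * (Real.exp (2 * η * τ) - 1)
      / (β - η - (β + η) * Real.exp (2 * η * τ)))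
    (B : ℝ → ℝ)
    (hB : ∀ τ, B τ =
      ((α * β + (b * σ ^ 2 - α * β ^ 2) * β / η ^ 2)
          * (-(β + η) * (Real.exp (2 * η * τ) - 1) - 2 * η)
        + (b * σ ^ 2 - α * β ^ 2) * (β ^ 2 - η ^ 2) / η ^ 2
          * (Real.exp (2 * η * τ) - 1)
        + 2 * η * Real.exp (η * τ)
          * (b * σ ^ 2 * η ^ 2 - 2 * c * σ ^ 2 * (b * σ ^ 2 - α * β ^ 2))
          / (β * η ^ 2))
      / (σ ^ 2 * ((β + η) * (Real.exp (2 * η * τ) - 1) + 2 * η))) :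
    (∀ τ ≥ (0 : ℝ), σ ^ 2 * ((β + η) * (Real.exp (2 * η * τ) - 1) + 2 * η) ≠ 0) ∧
    B 0 = 0 ∧
    (∀ τ ∈ Ici (0 : ℝ),
      HasDerivWithinAt B
        (α * β * A τ - β * B τ + σ ^ 2 * A τ * B τ - b) (Ici 0) τ) := by
  have hσ2 : 0 < σ ^ 2 := by positivity
  have hη_pos : 0 < η := by rw [hη]; positivity
  have hη_sq : η ^ 2 = β ^ 2 + 2 * c * σ ^ 2 := by
    rw [hη, Real.sq_sqrt (by positivity)]
  have hβη : 0 < β + η := by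
    have : |β| < η := by
      rw [hη]
      exact Real.lt_sqrt_of_sq_lt (by rw [sq_abs]; nlinarith [mul_pos hc hσ2])
    linarith [neg_abs_le β]
  have hD : ∀ τ ≥ (0 : ℝ), 0 < (β + η) * (Real.exp (2 * η * τ) - 1) + 2 * η := by
    intro τ hτ
    have : 0 ≤ Real.exp (2 * η * τ) - 1 := sub_nonneg.2 (Real.one_le_exp (by positivity))
    positivity
  have hc_eq : c = (η ^ 2 - β ^ 2) / (2 * σ ^ 2) := by
    rw [hη_sq]; field_simp; ring
  have hη_ne : η ≠ 0 := hη_pos.ne'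
  refine ⟨fun τ hτ => mul_ne_zero hσ2.ne' (hD τ hτ).ne', ?_, ?_⟩
  · rw [hB, hc_eq]
    simp only [mul_zero, Real.exp_zero]
    field_simp
    ring
  · intro τ hτ
    have hDτ := (hD τ hτ).ne'
    have hE₁ : HasDerivAt (fun t => Real.exp (η * t)) (Real.exp (η * τ) * η) τ := by
      simpa using ((hasDerivAt_id τ).const_mul η).exp
    have hE₂ : HasDerivAt (fun t => Real.exp (2 * η * t)) (Real.exp (2 * η * τ) * (2 * η)) τ := by
      simpa using ((hasDerivAt_id τ).const_mul (2 * η)).exp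
    have hE_sq : Real.exp (2 * η * τ) = Real.exp (η * τ) ^ 2 := by
      rw [← Real.exp_nat_mul]; push_cast; ring_nf
    have hB_deriv := (((((hE₂.sub_const 1).const_mul (-(β + η))).sub_const (2 * η)).const_mul
        (α * β + (b * σ ^ 2 - α * β ^ 2) * β / η ^ 2)).add
      ((hE₂.sub_const 1).const_mul ((b * σ ^ 2 - α * β ^ 2) * (β ^ 2 - η ^ 2) / η ^ 2)) |>.add
      (((hE₁.const_mul (2 * η)).mul_const
        (b * σ ^ 2 * η ^ 2 - 2 * c * σ ^ 2 * (b * σ ^ 2 - α * β ^ 2))).div_const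
          (β * η ^ 2))).div
      ((((hE₂.sub_const 1).const_mul (β + η)).add_const (2 * η)).const_mul (σ ^ 2))
      (mul_ne_zero hσ2.ne' hDτ)
    rw [funext hB]
    refine (hB_deriv.congr_deriv ?_).hasDerivWithinAt
    have hA_den : β - η - (β + η) * Real.exp (2 * η * τ)
        = -((β + η) * (Real.exp (2 * η * τ) - 1) + 2 * η) := by ring
    simp only [Pi.add_apply]
    rw [hA, hA_den, hc_eq]
    rw [hE_sq] at hDτ ⊢
    generalize Real.exp (η * τ) = E at hDτ ⊢
    have hDτ' : (β + η) * (E ^ 2 - 1) + η * 2 ≠ 0 := by rwa [mul_comm η 2]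
    field_simp
    ring
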